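/- Suppose nonnegative quantities satisfy, for all 0<r≤ρ/4 ≤ r₀ and given ε>0: (i) Ψ(r/2) ≤ C[ε²(ρ/r)³ + ε(ρ/r)² + (ε^{1/2}+ε)(ρ/r) + ε + (r/ρ)²]Ψ(ρ) + Cε Q₁(ρ) + Cε + Cε(r/ρ)^{γ} Q(ρ); (ii) Q₁(r) ≤ C[(ρ/r)+(r/ρ)]Ψ(ρ) + C(r/ρ)(Q₁(ρ)+1); (iii) Q(r) ≤ C(ρ/r)Q₁(ρ) + C(r/ρ)^{γ}Q(ρ), where γ = 3/κ*-1 > 0. Then there exist θ ∈ (0,1/4) and ε₁, ε₂, ε > 0 (depending only on C, γ, and a target ε*>0) such that Φ(r) := Ψ(r) + ε₁Q₁(r) + ε₂Q(r) satisfies Φ(θr) ≤ ε*/8 + Φ(r)/2 for all r ≤ r₀; consequently Φ(r) ≤ ε*/4 for all sufficiently small r. -/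

import Mathlib

open Set

/-- A function that is bounded above on `[θ a, a]` and satisfies `f (θ r) ≤ c + f r / 2` on `(0, a]`
is eventually at most `2 c + δ` near `0`, for every `δ > 0`. -/
theorem exists_le_of_halving {f : ℝ → ℝ} {θ a c δ M : ℝ} (hθ : 0 < θ) (hθ1 : θ < 1) (ha : 0 < a)
    (hδ : 0 < δ) (hM : ∀ r ∈ Icc (θ * a) a, f r ≤ M)
    (hf : ∀ r, 0 < r → r ≤ a → f (θ * r) ≤ c + f r / 2) :
    ∃ r₁ > 0, ∀ r, 0 < r → r < r₁ → f r ≤ 2 * c + δ := by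
  have iter : ∀ (n : ℕ) (t : ℝ), 0 < t → t ≤ a →
      f (θ ^ n * t) - 2 * c ≤ (f t - 2 * c) * (1 / 2) ^ n := by
    intro n t ht hta
    induction n with
    | zero => simp
    | succ k ih =>
      have hle : θ ^ k * t ≤ a :=
        (mul_le_of_le_one_left ht.le (pow_le_one₀ hθ.le hθ1.le)).trans hta
      have h := hf (θ ^ k * t) (by positivity) hle
      rw [← mul_assoc, ← pow_succ'] at h
      rw [pow_succ (1 / 2 : ℝ) k]
      linarith
  set B := max (M - 2 * c) 1
  have hB : 0 < B := lt_max_of_lt_right one_pos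
  obtain ⟨N, hN⟩ := exists_pow_lt_of_lt_one (div_pos hδ hB) (by norm_num : (1 / 2 : ℝ) < 1)
  refine ⟨θ ^ N * a, by positivity, fun r hr hrN => ?_⟩
  have hra : r / a < θ ^ N := by rwa [div_lt_iff₀ ha]
  obtain ⟨n, hn1, hn2⟩ := exists_nat_pow_near_of_lt_one (div_pos hr ha)
    (hra.le.trans (pow_le_one₀ hθ.le hθ1.le)) hθ hθ1
  have hNn : N ≤ n := by
    have := (pow_lt_pow_iff_right_of_lt_one₀ hθ hθ1).1 (hn1.trans hra)
    omega
  have hpn : 0 < θ ^ n := by positivity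
  have hta : r / θ ^ n ≤ a := by
    rw [div_le_iff₀ hpn]; rw [div_le_iff₀ ha] at hn2; linarith
  have htθ : θ * a ≤ r / θ ^ n := by
    rw [le_div_iff₀ hpn]; rw [lt_div_iff₀ ha, pow_succ] at hn1; linarith
  have h := iter n (r / θ ^ n) (by positivity) hta
  rw [mul_div_cancel₀ r hpn.ne'] at h
  have h1 : f (r / θ ^ n) - 2 * c ≤ B :=
    (sub_le_sub_right (hM _ ⟨htθ, hta⟩) _).trans (le_max_left _ _)
  have h2 : (1 / 2 : ℝ) ^ n ≤ δ / B :=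
    (pow_le_pow_of_le_one (by norm_num) (by norm_num) hNn).trans hN.le
  have h3 : (f (r / θ ^ n) - 2 * c) * (1 / 2) ^ n ≤ B * (δ / B) := by gcongr
  rw [mul_div_cancel₀ _ hB.ne'] at h3
  linarith

open Filter Topology in
/-- A real function continuous at `0` and vanishing there is small to the right of `0`. -/
theorem eventually_le_of_continuousAt_zero {g : ℝ → ℝ} {b : ℝ} (hg : ContinuousAt g 0)
    (h0 : g 0 < b) : ∀ᶠ x in 𝓝[>] (0 : ℝ), g x ≤ b :=
  ((hg.eventually_lt continuousAt_const h0).filter_mono nhdsWithin_le_nhds).mono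
    fun _ h => h.le

open Filter Topology in
/-- Choice of the parameters for the absorption argument: first the ratio `θ`, then the weights
`ε₁` and `ε₂`, and finally `ε`. -/
theorem exists_absorption_parameters {C γ η : ℝ} (hγ : 0 < γ) (hη : 0 < η) :
    ∃ θ ε₁ ε₂ ε : ℝ, 0 < θ ∧ θ ≤ 1 / 8 ∧ 0 < ε₁ ∧ 0 < ε₂ ∧ 0 < ε ∧
      C * (ε ^ 2 * (1 / (2 * θ)) ^ 3 + ε * (1 / (2 * θ)) ^ 2 + (√ε + ε) * (1 / (2 * θ)) + ε
        + (2 * θ) ^ 2) + ε₁ * (C * (1 / θ + θ)) ≤ 1 / 2 ∧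
      C * ε + ε₁ * (C * θ) + ε₂ * (C * (1 / θ)) ≤ ε₁ / 2 ∧
      C * ε * (2 * θ) ^ γ + ε₂ * (C * θ ^ γ) ≤ ε₂ / 2 ∧
      C * ε + ε₁ * (C * θ) ≤ η := by
  obtain ⟨θ, hθ, hθ8, h1, h2, h3⟩ : ∃ θ : ℝ, 0 < θ ∧ θ ≤ 1 / 8 ∧ C * (2 * θ) ^ 2 ≤ 1 / 8 ∧
      C * θ ≤ 1 / 8 ∧ C * θ ^ γ ≤ 1 / 4 := by
    refine Eventually.exists (f := 𝓝[>] (0 : ℝ)) ?_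
    refine eventually_mem_nhdsWithin.and <| .and ?_ <| .and ?_ <| .and ?_ ?_ <;>
      apply eventually_le_of_continuousAt_zero
    · fun_prop
    · norm_num
    · fun_prop
    · norm_num
    · fun_prop
    · norm_num
    · exact continuousAt_const.mul (Real.continuousAt_rpow_const _ _ (Or.inr hγ.le))
    · simp [Real.zero_rpow hγ.ne']
  obtain ⟨ε₁, hε₁, h4, h5⟩ : ∃ ε₁ : ℝ, 0 < ε₁ ∧ ε₁ * (C * (1 / θ + θ)) ≤ 1 / 8 ∧
      ε₁ * (C * θ) ≤ η / 2 := by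
    refine Eventually.exists (f := 𝓝[>] (0 : ℝ)) ?_
    refine eventually_mem_nhdsWithin.and <| .and ?_ ?_ <;>
      apply eventually_le_of_continuousAt_zero
    · fun_prop
    · norm_num
    · fun_prop
    · simpa using hη
  obtain ⟨ε₂, hε₂, h6⟩ : ∃ ε₂ : ℝ, 0 < ε₂ ∧ ε₂ * (C * (1 / θ)) ≤ ε₁ / 8 := by
    refine Eventually.exists (f := 𝓝[>] (0 : ℝ)) ?_
    refine eventually_mem_nhdsWithin.and ?_
    apply eventually_le_of_continuousAt_zero
    · fun_prop
    · simpa using hε₁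
  obtain ⟨ε, hε, h7, h8, h9, h10⟩ : ∃ ε : ℝ, 0 < ε ∧
      C * (ε ^ 2 * (1 / (2 * θ)) ^ 3 + ε * (1 / (2 * θ)) ^ 2 + (√ε + ε) * (1 / (2 * θ)) + ε)
        ≤ 1 / 8 ∧
      C * ε ≤ ε₁ / 8 ∧ C * ε * (2 * θ) ^ γ ≤ ε₂ / 4 ∧ C * ε ≤ η / 2 := by
    refine Eventually.exists (f := 𝓝[>] (0 : ℝ)) ?_
    refine eventually_mem_nhdsWithin.and <| .and ?_ <| .and ?_ <| .and ?_ ?_ <;>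
      apply eventually_le_of_continuousAt_zero
    · fun_prop
    · simp
    · fun_prop
    · simpa using hε₁
    · fun_prop
    · simpa using hε₂
    · fun_prop
    · simpa using hη
  refine ⟨θ, ε₁, ε₂, ε, hθ, hθ8, hε₁, hε₂, hε, ?_, ?_, ?_, ?_⟩
  · linarith
  · have := mul_le_mul_of_nonneg_left h2 hε₁.le
    linarith
  · have := mul_le_mul_of_nonneg_left h3 hε₂.le
    linarith
  · linarith



/-- The full absorption/iteration scheme in the proof of Theorem 1.1 of
Kang–Kim: given the local energy estimate (i), the pressure-gradient estimate
(ii) and the pressure decay estimate (iii), one can choose `θ ∈ (0,1/4)` and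
`ε₁, ε₂, ε > 0` so that `Φ = Ψ + ε₁Q₁ + ε₂Q` satisfies
`Φ(θr) ≤ ε*/8 + Φ(r)/2`, hence `Φ(r) ≤ ε*/4` for all small `r`. -/
theorem stmt15 (C γ εstar : ℝ) (hC : 0 < C) (hγ : 0 < γ) (hεs : 0 < εstar) :
    ∃ θ ∈ Ioo (0:ℝ) (1/4), ∃ ε₁ > (0:ℝ), ∃ ε₂ > (0:ℝ), ∃ ε > (0:ℝ),
      ∀ (Ψ Q₁ Q : ℝ → ℝ) (r₀ : ℝ), 0 < r₀ →
      (∀ r ∈ Ioc (0:ℝ) r₀, 0 ≤ Ψ r ∧ 0 ≤ Q₁ r ∧ 0 ≤ Q r) →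
      (∀ r ρ : ℝ, 0 < r → r ≤ ρ/4 → ρ ≤ r₀ →
        Ψ (r/2) ≤ C * ((ε^2 * (ρ/r)^3 + ε * (ρ/r)^2 +
            (Real.sqrt ε + ε) * (ρ/r) + ε + (r/ρ)^2) * Ψ ρ)
          + C * ε * Q₁ ρ + C * ε + C * ε * (r/ρ)^γ * Q ρ) →
      (∀ r ρ : ℝ, 0 < r → r ≤ ρ/4 → ρ ≤ r₀ →
        Q₁ r ≤ C * ((ρ/r) + (r/ρ)) * Ψ ρ + C * (r/ρ) * (Q₁ ρ + 1)) →
      (∀ r ρ : ℝ, 0 < r → r ≤ ρ/4 → ρ ≤ r₀ →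
        Q r ≤ C * (ρ/r) * Q₁ ρ + C * (r/ρ)^γ * Q ρ) →
      (∀ r : ℝ, 0 < r → r ≤ r₀ →
        Ψ (θ*r) + ε₁ * Q₁ (θ*r) + ε₂ * Q (θ*r) ≤
          εstar/8 + (Ψ r + ε₁ * Q₁ r + ε₂ * Q r) / 2) ∧
      ∃ r₁ > (0:ℝ), ∀ r : ℝ, 0 < r → r < r₁ →
        Ψ r + ε₁ * Q₁ r + ε₂ * Q r ≤ εstar/4 := by
  obtain ⟨θ, ε₁, ε₂, ε, hθ, hθ8, hε₁, hε₂, hε, hcΨ, hcQ₁, hcQ, hc⟩ :=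
    exists_absorption_parameters (C := C) hγ (show 0 < εstar / 16 by positivity)
  refine ⟨θ, ⟨hθ, by linarith⟩, ε₁, hε₁, ε₂, hε₂, ε, hε, ?_⟩
  intro Ψ Q₁ Q r₀ hr₀ hnn hΨ hQ₁ hQ
  have step : ∀ r : ℝ, 0 < r → r ≤ r₀ → Ψ (θ*r) + ε₁ * Q₁ (θ*r) + ε₂ * Q (θ*r) ≤
      εstar/16 + (Ψ r + ε₁ * Q₁ r + ε₂ * Q r) / 2 := by
    intro r hr hrr
    obtain ⟨p1, p2, p3⟩ := hnn r ⟨hr, hrr⟩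
    have e1 := hΨ (2 * θ * r) r (by positivity) (by nlinarith) hrr
    have e2 := hQ₁ (θ * r) r (by positivity) (by nlinarith) hrr
    have e3 := hQ (θ * r) r (by positivity) (by nlinarith) hrr
    rw [show 2 * θ * r / 2 = θ * r by ring, show r / (2 * θ * r) = 1 / (2 * θ) by field_simp,
      mul_div_cancel_right₀ _ hr.ne'] at e1
    rw [show r / (θ * r) = 1 / θ by field_simp, mul_div_cancel_right₀ _ hr.ne'] at e2 e3
    have f2 := mul_le_mul_of_nonneg_left e2 hε₁.le
    have f3 := mul_le_mul_of_nonneg_left e3 hε₂.le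
    have g1 := mul_le_mul_of_nonneg_right hcΨ p1
    have g2 := mul_le_mul_of_nonneg_right hcQ₁ p2
    have g3 := mul_le_mul_of_nonneg_right hcQ p3
    linarith
  refine ⟨fun r hr hrr => (step r hr hrr).trans (by linarith), ?_⟩
  obtain ⟨p1, p2, p3⟩ := hnn r₀ ⟨hr₀, le_rfl⟩
  have ratio_bounds : ∀ t, θ * (r₀ / 8) ≤ t → t ≤ r₀ / 4 →
      0 < t ∧ r₀ / t ≤ 8 / θ ∧ 0 ≤ r₀ / t ∧ t / r₀ ≤ 1 ∧ 0 ≤ t / r₀ ∧ (t / r₀) ^ γ ≤ 1 := by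
    intro t h1 h2
    have ht : 0 < t := lt_of_lt_of_le (by positivity) h1
    have h3 : t / r₀ ≤ 1 := by rw [div_le_one hr₀]; linarith
    refine ⟨ht, ?_, by positivity, h3, by positivity,
      Real.rpow_le_one (by positivity) h3 hγ.le⟩
    rw [div_le_div_iff₀ ht hθ]
    linarith
  have bounded : ∀ t ∈ Icc (θ * (r₀ / 8)) (r₀ / 8), Ψ t + ε₁ * Q₁ t + ε₂ * Q t ≤
      (C * ((ε^2 * (8/θ)^3 + ε * (8/θ)^2 + (√ε + ε) * (8/θ) + ε + 1^2) * Ψ r₀)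
          + C * ε * Q₁ r₀ + C * ε + C * ε * 1 * Q r₀)
        + ε₁ * (C * (8/θ + 1) * Ψ r₀ + C * 1 * (Q₁ r₀ + 1))
        + ε₂ * (C * (8/θ) * Q₁ r₀ + C * 1 * Q r₀) := by
    rintro t ⟨ht1, ht2⟩
    obtain ⟨ht, a1, a2, a3, a4, a5⟩ := ratio_bounds t ht1 (by linarith)
    obtain ⟨ht', b1, b2, b3, b4, b5⟩ := ratio_bounds (2 * t) (by linarith) (by linarith)
    have e1 := hΨ (2 * t) r₀ ht' (by linarith) le_rfl
    rw [mul_div_cancel_left₀ t two_ne_zero] at e1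
    have e2 := hQ₁ t r₀ ht (by linarith) le_rfl
    have e3 := hQ t r₀ ht (by linarith) le_rfl
    refine add_le_add (add_le_add (e1.trans ?_) (mul_le_mul_of_nonneg_left (e2.trans ?_) hε₁.le))
      (mul_le_mul_of_nonneg_left (e3.trans ?_) hε₂.le) <;> gcongr
  obtain ⟨r₁, hr₁, h⟩ := exists_le_of_halving (f := fun r => Ψ r + ε₁ * Q₁ r + ε₂ * Q r)
    (δ := εstar / 8) hθ (by linarith) (by positivity) (by positivity) bounded
    (fun r hr hr8 => step r hr (by linarith))
  exact ⟨r₁, hr₁, fun r hr hr1 => (h r hr hr1).trans (by linarith)⟩
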